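/- Let α ∈ (0,1), ρ ∈ (0,1], T > 0, τ > 0, let A and B be n×n real matrices, let ω : [−τ, 0] → ℝⁿ be continuous, and let f : [0,T] × ℝⁿ × ℝⁿ → ℝⁿ be continuous. A function y : [−τ, T] → ℝⁿ, continuously differentiable on [0,T], satisfies y(t) = ω(t) on [−τ, 0] and the tempered fractional equation (1/Γ(1−α)) ∫₀ᵗ e^{−ρ(t−s)} (t−s)^{−α} (ρ y(s) + y′(s)) ds = e^{−ρt} (A y(t) + B y(t−τ) + f(t, y(t), y(t−τ))) for all t ∈ [0,T], if and only if y satisfies y(t) = ω(t) on [−τ, 0] and the integral equation y(t) = ω(0) e^{−ρt} + (1/Γ(α)) ∫₀ᵗ e^{−ρ(t−s)} e^{−ρs} (t−s)^{α−1} [A y(s) + B y(s−τ) + f(s, y(s), y(s−τ))] ds for all t ∈ [0,T]. -/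

import Mathlib

open MeasureTheory Real Set

theorem aux_beta0 {a b c : ℝ} (ha : 0 < a) (hb : 0 < b) (hab : a + b = 1) (hc : 0 < c) :
    ∫ x in (0:ℝ)..c, x ^ (b - 1) * (c - x) ^ (a - 1) = Real.Gamma a * Real.Gamma b := by
  have h := Complex.betaIntegral_scaled (b : ℂ) (a : ℂ) hc
  have h2 := Complex.Gamma_mul_Gamma_eq_betaIntegral (s := (b : ℂ)) (t := (a : ℂ))
    (by simpa using hb) (by simpa using ha)
  have h3 : (b : ℂ) + a = 1 := by rw [add_comm]; exact_mod_cast congrArg (fun x : ℝ => (x : ℂ)) hab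
  rw [h3] at h h2
  rw [Complex.Gamma_one, one_mul] at h2
  rw [sub_self, Complex.cpow_zero, one_mul, ← h2, Complex.Gamma_ofReal, Complex.Gamma_ofReal] at h
  apply Complex.ofReal_injective
  rw [← intervalIntegral.integral_ofReal]
  push_cast
  rw [mul_comm, ← h]
  apply intervalIntegral.integral_congr
  intro x hx
  rw [uIcc_of_le hc.le] at hx
  dsimp only
  rw [Complex.ofReal_cpow hx.1, Complex.ofReal_cpow (sub_nonneg.2 hx.2)]
  push_cast
  rfl

theorem aux_beta {a b r t : ℝ} (ha : 0 < a) (hb : 0 < b) (hab : a + b = 1) (hc : r < t) :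
    ∫ s in r..t, (t - s) ^ (a - 1) * (s - r) ^ (b - 1) = Real.Gamma a * Real.Gamma b := by
  rw [← aux_beta0 ha hb hab (sub_pos.2 hc)]
  have := intervalIntegral.integral_comp_sub_right (a := r) (b := t)
    (fun x : ℝ => x ^ (b - 1) * ((t - r) - x) ^ (a - 1)) r
  rw [sub_self] at this
  rw [← this]
  congr 1
  ext x
  rw [mul_comm]
  congr 2
  ring

theorem aux_beta_int {a b r t : ℝ} (ha : 0 < a) (hb : 0 < b) (hab : a + b = 1) (hc : r < t) :
    IntegrableOn (fun s => (t - s) ^ (a - 1) * (s - r) ^ (b - 1)) (Ioo r t) := by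
  rw [← integrableOn_Ioc_iff_integrableOn_Ioo, ← intervalIntegrable_iff_integrableOn_Ioc_of_le hc.le]
  by_contra h
  have h1 := aux_beta ha hb hab hc
  rw [intervalIntegral.integral_undef h] at h1
  have := mul_pos (Real.Gamma_pos_of_pos ha) (Real.Gamma_pos_of_pos hb)
  linarith

theorem aux_semigroup {E : Type*} [NormedAddCommGroup E] [NormedSpace ℝ E] [CompleteSpace E]
    {a b t : ℝ} (ha : 0 < a) (hb : 0 < b) (hab : a + b = 1) (ht : 0 ≤ t)
    (g : ℝ → E) (hg : Continuous g) :
    ∫ s in (0:ℝ)..t, (t - s) ^ (a - 1) • ∫ r in (0:ℝ)..s, (s - r) ^ (b - 1) • g r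
      = (Real.Gamma a * Real.Gamma b) • ∫ s in (0:ℝ)..t, g s := by
  set μ : Measure ℝ := volume.restrict (Ioo 0 t) with hμ
  let K : ℝ → ℝ → ℝ := fun r s => (Ioi r).indicator (fun s => (t - s) ^ (a - 1) * (s - r) ^ (b - 1)) s
  have hinter : ∀ r ∈ Ioo 0 t, Ioo 0 t ∩ Ioi r = Ioo r t := by
    intro r hr; ext x; simp only [mem_inter_iff, mem_Ioo, mem_Ioi]
    constructor
    · rintro ⟨⟨h1, h2⟩, h3⟩; exact ⟨h3, h2⟩
    · rintro ⟨h1, h2⟩; exact ⟨⟨hr.1.trans h1, h2⟩, h1⟩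
  have hinter' : ∀ r ∈ Ioo 0 t, Ioo 0 t ∩ Iio r = Ioo 0 r := by
    intro r hr; ext x; simp only [mem_inter_iff, mem_Ioo, mem_Iio]
    constructor
    · rintro ⟨⟨h1, h2⟩, h3⟩; exact ⟨h1, h3⟩
    · rintro ⟨h1, h2⟩; exact ⟨⟨h1, h2.trans hr.2⟩, h2⟩
  have hKsec : ∀ r ∈ Ioo 0 t, Integrable (K r) μ := by
    intro r hr
    rw [integrable_indicator_iff measurableSet_Ioi, IntegrableOn, hμ,
      Measure.restrict_restrict measurableSet_Ioi, inter_comm, hinter r hr]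
    exact aux_beta_int ha hb hab hr.2
  have hKint : ∀ r ∈ Ioo 0 t, ∫ s, K r s ∂μ = Real.Gamma a * Real.Gamma b := by
    intro r hr
    rw [hμ]
    simp only [K]
    rw [setIntegral_indicator measurableSet_Ioi, hinter r hr, ← integral_Ioc_eq_integral_Ioo,
      ← intervalIntegral.integral_of_le hr.2.le]
    exact aux_beta ha hb hab hr.2
  have hKnn : ∀ r, ∀ s ∈ Ioo 0 t, 0 ≤ K r s := by
    intro r s hs
    simp only [K]
    by_cases h : r < s
    · rw [indicator_of_mem (by exact h)]
      have := hs.2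
      exact mul_nonneg (rpow_nonneg (by linarith) _) (rpow_nonneg (by linarith) _)
    · rw [indicator_of_notMem (by exact h)]
  have hKmeas : Measurable (fun p : ℝ × ℝ => K p.2 p.1) := by
    have : (fun p : ℝ × ℝ => K p.2 p.1) = {p : ℝ × ℝ | p.2 < p.1}.indicator
      (fun p => (t - p.1) ^ (a - 1) * (p.1 - p.2) ^ (b - 1)) := by
      ext p
      simp [K, indicator]
    rw [this]
    exact Measurable.indicator (by fun_prop) (measurableSet_lt measurable_snd measurable_fst)
  have hKprod : Integrable (fun p : ℝ × ℝ => K p.2 p.1) (μ.prod μ) := by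
    rw [integrable_prod_iff' hKmeas.aestronglyMeasurable]
    constructor
    · filter_upwards [ae_restrict_mem measurableSet_Ioo] with r hr using hKsec r hr
    · have : (fun _ : ℝ => Real.Gamma a * Real.Gamma b) =ᵐ[μ] fun r => ∫ s, ‖K r s‖ ∂μ := by
        filter_upwards [ae_restrict_mem measurableSet_Ioo] with r hr
        rw [← hKint r hr]
        apply integral_congr_ae
        filter_upwards [ae_restrict_mem measurableSet_Ioo] with s hs
        rw [Real.norm_of_nonneg (hKnn r s hs)]
      exact (integrable_const _).congr this
  obtain ⟨C, hC⟩ := (isCompact_Icc (a := (0:ℝ)) (b := t)).exists_bound_of_continuousOn hg.continuousOn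
  have hKg : Integrable (fun p : ℝ × ℝ => K p.2 p.1 • g p.2) (μ.prod μ) := by
    refine (hKprod.norm.const_mul C).mono' (hKmeas.aestronglyMeasurable.smul (hg.comp continuous_snd).aestronglyMeasurable) ?_
    have : ∀ᵐ p ∂(μ.prod μ), p ∈ Ioo 0 t ×ˢ Ioo 0 t := by
      rw [hμ, Measure.prod_restrict]
      exact ae_restrict_mem (measurableSet_Ioo.prod measurableSet_Ioo)
    filter_upwards [this] with p hp
    rw [norm_smul, mul_comm]
    exact mul_le_mul_of_nonneg_right (hC _ ⟨hp.2.1.le, hp.2.2.le⟩) (norm_nonneg _)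
  have hswap := integral_integral_swap (f := fun s r => K r s • g r) hKg
  have h1 : ∫ s in (0:ℝ)..t, (t - s) ^ (a - 1) • ∫ r in (0:ℝ)..s, (s - r) ^ (b - 1) • g r
      = ∫ s, ∫ r, K r s • g r ∂μ ∂μ := by
    rw [intervalIntegral.integral_of_le ht, integral_Ioc_eq_integral_Ioo]
    apply setIntegral_congr_fun measurableSet_Ioo
    intro s hs
    dsimp only
    rw [← intervalIntegral.integral_smul, intervalIntegral.integral_of_le hs.1.le,
      integral_Ioc_eq_integral_Ioo, ← hinter' s hs, ← setIntegral_indicator measurableSet_Iio]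
    congr 1
    ext r
    by_cases h : r < s
    · simp [K, indicator, h, smul_smul]
    · simp [K, indicator, h]
  have h2 : ∫ r, ∫ s, K r s • g r ∂μ ∂μ = (Real.Gamma a * Real.Gamma b) • ∫ s in (0:ℝ)..t, g s := by
    rw [intervalIntegral.integral_of_le ht, integral_Ioc_eq_integral_Ioo, ← integral_smul]
    apply setIntegral_congr_fun measurableSet_Ioo
    intro r hr
    dsimp only
    rw [integral_smul_const, hKint r hr]
  rw [h1, hswap, h2]

theorem aux_cont {E : Type*} [NormedAddCommGroup E] [NormedSpace ℝ E]
    {a : ℝ} (ha : 0 < a) (g : ℝ → E) (hg : Continuous g) :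
    ContinuousOn (fun t : ℝ => ∫ s in (0:ℝ)..t, (t - s) ^ (a - 1) • g s) (Ici 0) := by
  have hi : IntervalIntegrable (fun u : ℝ => (1 - u) ^ (a - 1)) volume 0 1 := by
    have := (intervalIntegral.intervalIntegrable_rpow' (a := 0) (b := 1) (r := a - 1)
      (by linarith)).comp_sub_left 1
    simpa using this.symm
  have hc : Continuous (fun t : ℝ => ∫ u in (0:ℝ)..1, (1 - u) ^ (a - 1) • g (t * u)) := by
    rw [continuous_iff_continuousAt]
    intro t
    obtain ⟨C, hC⟩ := ((isCompact_closedBall t 1).prod (isCompact_Icc (a := (0:ℝ)) (b := 1))).exists_bound_of_continuousOn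
      (f := fun p : ℝ × ℝ => g (p.1 * p.2)) (by fun_prop)
    apply intervalIntegral.continuousAt_of_dominated_interval
      (bound := fun u => |(1 - u) ^ (a - 1)| * C)
    · filter_upwards with x
      exact (by fun_prop : Measurable (fun u : ℝ => (1 - u) ^ (a - 1))).aestronglyMeasurable.smul
        (by fun_prop : Continuous (fun u => g (x * u))).aestronglyMeasurable
    · filter_upwards [Metric.closedBall_mem_nhds t one_pos] with x hx
      filter_upwards with u hu
      rw [uIoc_of_le zero_le_one] at hu
      rw [norm_smul, Real.norm_eq_abs]
      exact mul_le_mul_of_nonneg_left (hC (x, u) ⟨hx, hu.1.le, hu.2⟩) (abs_nonneg _)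
    · exact hi.abs.mul_const C
    · filter_upwards with u hu
      fun_prop
  have : ContinuousOn (fun t : ℝ => t ^ a • ∫ u in (0:ℝ)..1, (1 - u) ^ (a - 1) • g (t * u)) (Ici 0) :=
    ((continuous_id.rpow_const (fun _ => Or.inr ha.le)).smul hc).continuousOn
  refine this.congr ?_
  intro t ht
  rcases eq_or_lt_of_le (show (0:ℝ) ≤ t from ht) with rfl | ht
  · simp [ha.ne']
  dsimp only
  have h := intervalIntegral.smul_integral_comp_mul_left (a := 0) (b := 1) (fun s => (t - s) ^ (a - 1) • g s) t
  rw [mul_zero, mul_one] at h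
  rw [← h, show t ^ a = t * t ^ (a - 1) by rw [rpow_sub_one ht.ne']; field_simp, mul_smul,
    ← intervalIntegral.integral_smul (t ^ (a - 1))]
  congr 1
  apply intervalIntegral.integral_congr
  intro u hu
  rw [uIcc_of_le zero_le_one] at hu
  dsimp only
  rw [smul_smul, ← mul_rpow ht.le (by linarith [hu.2])]
  congr 2
  ring

theorem aux_core {E : Type*} [NormedAddCommGroup E] [NormedSpace ℝ E] [CompleteSpace E]
    {α T : ℝ} (h0 : 0 < α) (h1 : α < 1) (hT : 0 < T) (v F : ℝ → E)
    (hv : Continuous v) (hF : Continuous F) :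
    (∀ t ∈ Icc (0:ℝ) T, (Real.Gamma (1 - α))⁻¹ • (∫ s in (0:ℝ)..t, (t - s) ^ (-α) • v s) = F t) ↔
    (∀ t ∈ Icc (0:ℝ) T, (∫ s in (0:ℝ)..t, v s) =
      (Real.Gamma α)⁻¹ • ∫ s in (0:ℝ)..t, (t - s) ^ (α - 1) • F s) := by
  have hg0 := (Real.Gamma_pos_of_pos h0).ne'
  have hg1 := (Real.Gamma_pos_of_pos (sub_pos.2 h1)).ne'
  have key : ∀ t ∈ Icc (0:ℝ) T, (∫ s in (0:ℝ)..t, v s) = (Real.Gamma α)⁻¹ •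
      ∫ s in (0:ℝ)..t, (t - s) ^ (α - 1) •
        ((Real.Gamma (1 - α))⁻¹ • (∫ r in (0:ℝ)..s, (s - r) ^ (-α) • v r)) := by
    intro t ht
    have h := aux_semigroup h0 (sub_pos.2 h1) (by ring) ht.1 v hv
    rw [show 1 - α - 1 = -α by ring] at h
    simp_rw [smul_comm _ ((Real.Gamma (1 - α))⁻¹)]
    rw [intervalIntegral.integral_smul, h, smul_smul, smul_smul]
    rw [show (Real.Gamma α)⁻¹ * (Real.Gamma (1 - α))⁻¹ * (Real.Gamma α * Real.Gamma (1 - α)) = 1 by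
      field_simp, one_smul]
  constructor
  · intro H t ht
    rw [key t ht]
    congr 1
    apply intervalIntegral.integral_congr
    intro s hs
    rw [uIcc_of_le ht.1] at hs
    dsimp only
    rw [H s ⟨hs.1, hs.2.trans ht.2⟩]
  · intro H
    set G0 : ℝ → E := fun t => (Real.Gamma (1 - α))⁻¹ • (∫ s in (0:ℝ)..t, (t - s) ^ (-α) • v s) with hG0
    have hG0c : ContinuousOn G0 (Icc 0 T) := by
      have := aux_cont (sub_pos.2 h1) v hv
      rw [show 1 - α - 1 = -α by ring] at this
      exact (this.mono Icc_subset_Ici_self).const_smul _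
    set G : ℝ → E := IccExtend hT.le ((Icc 0 T).domRestrict G0) with hG
    have hGc : Continuous G := hG0c.domRestrict.Icc_extend'
    have hGe : ∀ t ∈ Icc 0 T, G t = G0 t := fun t ht => by
      rw [hG, IccExtend_of_mem _ _ ht]; rfl
    have hJ : ∀ t ∈ Icc (0:ℝ) T, ∫ s in (0:ℝ)..t, (t - s) ^ (α - 1) • G s =
        ∫ s in (0:ℝ)..t, (t - s) ^ (α - 1) • F s := by
      intro t ht
      have e1 := key t ht
      rw [H t ht] at e1
      have e2 := smul_right_injective E (inv_ne_zero hg0) e1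
      rw [e2]
      apply intervalIntegral.integral_congr
      intro s hs
      rw [uIcc_of_le ht.1] at hs
      dsimp only
      rw [hGe s ⟨hs.1, hs.2.trans ht.2⟩]
    have hI : ∀ t ∈ Icc (0:ℝ) T, ∫ s in (0:ℝ)..t, G s = ∫ s in (0:ℝ)..t, F s := by
      intro t ht
      have e1 := aux_semigroup (sub_pos.2 h1) h0 (by ring) ht.1 G hGc
      have e2 := aux_semigroup (sub_pos.2 h1) h0 (by ring) ht.1 F hF
      apply smul_right_injective E (mul_ne_zero hg1 hg0)
      dsimp only
      rw [← e1, ← e2]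
      apply intervalIntegral.integral_congr
      intro s hs
      rw [uIcc_of_le ht.1] at hs
      dsimp only
      rw [hJ s ⟨hs.1, hs.2.trans ht.2⟩]
    intro t ht
    have d1 := (hGc.integral_hasStrictDerivAt 0 t).hasDerivAt.hasDerivWithinAt (s := Icc 0 T)
    have d2 := (hF.integral_hasStrictDerivAt 0 t).hasDerivAt.hasDerivWithinAt (s := Icc 0 T)
    have d3 := d2.congr hI (hI t ht)
    have := (uniqueDiffOn_Icc hT t ht).eq_deriv _ d1 d3
    rw [← this, hGe t ht]

/-- **Equivalence between the tempered fractional delayed system and its integral equation.**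
Let `α ∈ (0,1)`, `ρ ∈ (0,1]`, `T > 0`, `τ > 0`, `A B` be `n × n` real matrices,
`ω : [−τ,0] → ℝⁿ` continuous and `f : [0,T] × ℝⁿ × ℝⁿ → ℝⁿ` continuous.  A continuously
differentiable function `y` (with derivative `yd` on `[0,T]`) satisfies `y = ω` on `[−τ,0]` and
`ᵀD₀^{α,ρ} y(t) = e^{−ρt}(A y(t) + B y(t−τ) + f(t, y(t), y(t−τ)))` on `[0,T]` if and only if
it satisfies `y = ω` on `[−τ,0]` and the corresponding integral equation on `[0,T]`. -/
theorem tempered_system_iff_integral_equation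
    {n : ℕ} (α ρ T τ : ℝ)
    (hα : α ∈ Set.Ioo (0:ℝ) 1) (hρ : ρ ∈ Set.Ioc (0:ℝ) 1) (hT : 0 < T) (hτ : 0 < τ)
    (A B : Matrix (Fin n) (Fin n) ℝ)
    (ω : ℝ → Fin n → ℝ) (hω : ContinuousOn ω (Set.Icc (-τ) 0))
    (f : ℝ → (Fin n → ℝ) → (Fin n → ℝ) → Fin n → ℝ)
    (hf : ContinuousOn (fun p : ℝ × (Fin n → ℝ) × (Fin n → ℝ) => f p.1 p.2.1 p.2.2)
      (Set.Icc 0 T ×ˢ Set.univ ×ˢ Set.univ))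
    (y yd : ℝ → Fin n → ℝ)
    (hy : ContinuousOn y (Set.Icc (-τ) T))
    (hyd : ∀ t ∈ Set.Icc (0:ℝ) T, HasDerivWithinAt y (yd t) (Set.Icc 0 T) t)
    (hydc : ContinuousOn yd (Set.Icc 0 T)) :
    ((∀ t ∈ Set.Icc (-τ) (0:ℝ), y t = ω t) ∧
      ∀ t ∈ Set.Icc (0:ℝ) T,
        (Real.Gamma (1 - α))⁻¹ •
            (∫ s in (0:ℝ)..t,
              (Real.exp (-ρ * (t - s)) * (t - s) ^ (-α)) • (ρ • y s + yd s)) =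
          Real.exp (-ρ * t) •
            (A.mulVec (y t) + B.mulVec (y (t - τ)) + f t (y t) (y (t - τ))))
    ↔
    ((∀ t ∈ Set.Icc (-τ) (0:ℝ), y t = ω t) ∧
      ∀ t ∈ Set.Icc (0:ℝ) T,
        y t = Real.exp (-ρ * t) • ω 0 + (Real.Gamma α)⁻¹ •
          ∫ s in (0:ℝ)..t,
            (Real.exp (-ρ * (t - s)) * Real.exp (-ρ * s) * (t - s) ^ (α - 1)) •
              (A.mulVec (y s) + B.mulVec (y (s - τ)) + f s (y s) (y (s - τ)))) := by
  obtain ⟨h0, h1⟩ := hα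
  refine and_congr_right fun hyω => ?_
  have hy0 : ω 0 = y 0 := (hyω 0 ⟨by linarith, le_rfl⟩).symm
  have hyc : ContinuousOn y (Icc 0 T) := hy.mono (Icc_subset_Icc_left (by linarith))
  have hyc' : ContinuousOn (fun t => y (t - τ)) (Icc 0 T) :=
    hy.comp (by fun_prop) (fun t ht => ⟨by linarith [ht.1], by linarith [ht.2]⟩)
  set F0 : ℝ → Fin n → ℝ := fun t =>
    A.mulVec (y t) + B.mulVec (y (t - τ)) + f t (y t) (y (t - τ)) with hF0
  have hF0c : ContinuousOn F0 (Icc 0 T) := by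
    have c1 : Continuous (fun x : Fin n → ℝ => A.mulVec x) := by fun_prop
    have c2 : Continuous (fun x : Fin n → ℝ => B.mulVec x) := by fun_prop
    refine ((c1.comp_continuousOn hyc).add (c2.comp_continuousOn hyc')).add ?_
    exact hf.comp (continuousOn_id.prodMk (hyc.prodMk hyc')) (fun t ht => ⟨ht, trivial, trivial⟩)
  set v0 : ℝ → Fin n → ℝ := fun s => Real.exp (ρ * s) • (ρ • y s + yd s) with hv0
  have hv0c : ContinuousOn v0 (Icc 0 T) :=
    (by fun_prop : Continuous fun s : ℝ => Real.exp (ρ * s)).continuousOn.smul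
      ((hyc.const_smul ρ).add hydc)
  set F : ℝ → Fin n → ℝ := IccExtend hT.le ((Icc 0 T).domRestrict F0) with hF
  have hFc : Continuous F := hF0c.domRestrict.Icc_extend'
  have hFe : ∀ t ∈ Icc 0 T, F t = F0 t := fun t ht => by
    rw [hF, IccExtend_of_mem _ _ ht]; rfl
  set v : ℝ → Fin n → ℝ := IccExtend hT.le ((Icc 0 T).domRestrict v0) with hv
  have hvc : Continuous v := hv0c.domRestrict.Icc_extend'
  have hve : ∀ t ∈ Icc 0 T, v t = v0 t := fun t ht => by
    rw [hv, IccExtend_of_mem _ _ ht]; rfl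
  have hftc : ∀ t ∈ Icc (0:ℝ) T, ∫ s in (0:ℝ)..t, v s = Real.exp (ρ * t) • y t - y 0 := by
    intro t ht
    have hsub : Icc 0 t ⊆ Icc 0 T := Icc_subset_Icc_right ht.2
    have := intervalIntegral.integral_eq_sub_of_hasDerivAt_of_le (a := 0) (b := t)
      (f := fun s => Real.exp (ρ * s) • y s) (f' := v) ht.1
      ((by fun_prop : Continuous fun s : ℝ => Real.exp (ρ * s)).continuousOn.smul (hyc.mono hsub))
      (fun s hs => by
        have hs' : s ∈ Icc 0 T := hsub (Ioo_subset_Icc_self hs)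
        have d1 : HasDerivAt y (yd s) s :=
          (hyd s hs').hasDerivAt (Icc_mem_nhds hs.1 (hs.2.trans_le ht.2))
        have d2 : HasDerivAt (fun s : ℝ => Real.exp (ρ * s)) (Real.exp (ρ * s) * ρ) s := by
          simpa using ((hasDerivAt_id s).const_mul ρ).exp
        have d3 := d2.smul d1
        rw [hve s hs']
        refine d3.congr_deriv ?_
        simp only [hv0, smul_add, smul_smul]
        rw [add_comm])
      (hvc.intervalIntegrable _ _)
    simpa using this
  have hcore := aux_core h0 h1 hT v F hvc hFc
  refine Iff.trans ?_ (hcore.trans ?_)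
  · refine forall₂_congr fun t ht => ?_
    have e : ∫ s in (0:ℝ)..t, (Real.exp (-ρ * (t - s)) * (t - s) ^ (-α)) • (ρ • y s + yd s)
        = Real.exp (-ρ * t) • ∫ s in (0:ℝ)..t, (t - s) ^ (-α) • v s := by
      rw [← intervalIntegral.integral_smul]
      apply intervalIntegral.integral_congr
      intro s hs
      rw [uIcc_of_le ht.1] at hs
      dsimp only
      rw [hve s ⟨hs.1, hs.2.trans ht.2⟩]
      simp only [hv0]
      rw [smul_smul, smul_smul, show -ρ * (t - s) = -ρ * t + ρ * s by ring, Real.exp_add]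
      congr 1
      ring
    rw [e, smul_comm, hFe t ht]
    exact (smul_right_injective _ (Real.exp_pos (-ρ * t)).ne').eq_iff
  · refine forall₂_congr fun t ht => ?_
    have e : ∫ s in (0:ℝ)..t,
            (Real.exp (-ρ * (t - s)) * Real.exp (-ρ * s) * (t - s) ^ (α - 1)) • F0 s
        = Real.exp (-ρ * t) • ∫ s in (0:ℝ)..t, (t - s) ^ (α - 1) • F s := by
      rw [← intervalIntegral.integral_smul]
      apply intervalIntegral.integral_congr
      intro s hs
      rw [uIcc_of_le ht.1] at hs
      dsimp only
      rw [hFe s ⟨hs.1, hs.2.trans ht.2⟩, smul_smul, ← Real.exp_add]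
      congr 3
      ring
    change _ ↔ y t = Real.exp (-ρ * t) • ω 0 + (Real.Gamma α)⁻¹ • ∫ s in (0:ℝ)..t,
            (Real.exp (-ρ * (t - s)) * Real.exp (-ρ * s) * (t - s) ^ (α - 1)) • F0 s
    rw [e, hftc t ht, hy0, smul_comm _ (Real.exp (-ρ * t)), ← smul_add,
      ← (smul_right_injective (Fin n → ℝ) (Real.exp_pos (ρ * t)).ne').eq_iff (a := y t)]
    rw [smul_smul (Real.exp (ρ * t)) (Real.exp (-ρ * t)), ← Real.exp_add,
      show ρ * t + -ρ * t = 0 by ring, Real.exp_zero, one_smul, sub_eq_iff_eq_add, add_comm]
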